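/- Let n ∈ ℕ, K ≥ 1, r > 0, δ > 0, and let f : ℝⁿ → ℝⁿ be continuously differentiable with f(0) = 0 and ‖Df(y)‖ ≤ L (operator norm) for all y ∈ ℝⁿ, and ‖f(y)‖ ≤ Q for all y ∈ B_{4Kr}. Let φ be a global solution map of ẋ = f(x) with ‖φ(t,y)‖ ≤ K‖y‖ for all t ≥ 0 and all y ∈ B_{2Kr}. Choose T > 0 with T < min(2Kr/Q, 1/L), an integer N > δ/T, and k ≥ 1 such that c(k) < K. Then for every x ∈ B_r and every i ∈ {0,…,N−1}, setting w := G_iᵏ(T,x), for all t ∈ [0,T]: ‖(D_x(Pᵏ 0)(t,·))(w)[f(w)] − ∂/∂t (Pᵏ 0)(t,w)‖ ≤ ((T·L)ᵏ / T)·(K + c(k))·‖x‖. -/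

import Mathlib

/-- The Picard operator acting on functions `z : ℝ × ℝⁿ → ℝⁿ`:
`(P z)(t,x) = x + ∫₀ᵗ f(z(s,x)) ds`. -/
noncomputable def picardT {n : ℕ} (f : EuclideanSpace ℝ (Fin n) → EuclideanSpace ℝ (Fin n))
    (z : ℝ → EuclideanSpace ℝ (Fin n) → EuclideanSpace ℝ (Fin n)) :
    ℝ → EuclideanSpace ℝ (Fin n) → EuclideanSpace ℝ (Fin n) :=
  fun t x => x + ∫ s in (0:ℝ)..t, f (z s x)

/-- The extended Picard iterates: `G₀ᵏ = Pᵏ 0`, `G_{i+1}ᵏ(t,x) = (Pᵏ 0)(t, G_iᵏ(T,x))`. -/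
noncomputable def GIter {n : ℕ} (f : EuclideanSpace ℝ (Fin n) → EuclideanSpace ℝ (Fin n))
    (T : ℝ) (k : ℕ) : ℕ → ℝ → EuclideanSpace ℝ (Fin n) → EuclideanSpace ℝ (Fin n)
  | 0 => (picardT f)^[k] 0
  | (i + 1) => fun t x => (picardT f)^[k] 0 t (GIter f T k i T x)

/-- `c(k) = Σ_{i=0}^{N−1} (e^{TL} + K·(TL)ᵏ)ⁱ · K² · (TL)ᵏ`. -/
noncomputable def cval (K T L : ℝ) (N k : ℕ) : ℝ :=
  ∑ i ∈ Finset.range N, (Real.exp (T * L) + K * (T * L) ^ k) ^ i * (K ^ 2 * (T * L) ^ k)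

open MeasureTheory Set Topology

section Parametric

variable {E G : Type*} [NormedAddCommGroup E] [NormedSpace ℝ E] [ProperSpace E]
  [NormedAddCommGroup G] [NormedSpace ℝ G]

theorem hasFDerivAt_intervalIntegral_of_continuous {F : ℝ → E → G} {F' : ℝ → E → E →L[ℝ] G}
    (hF : Continuous fun q : ℝ × E => F q.1 q.2) (hF' : Continuous fun q : ℝ × E => F' q.1 q.2)
    (hFF' : ∀ s x, HasFDerivAt (F s) (F' s x) x) (a b : ℝ) (x₀ : E) :
    HasFDerivAt (fun x => ∫ s in a..b, F s x) (∫ s in a..b, F' s x₀) x₀ := by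
  obtain ⟨C, hC⟩ := ((isCompact_uIcc (a := a) (b := b)).prod
    (isCompact_closedBall x₀ 1)).exists_bound_of_continuousOn hF'.continuousOn
  have hcont : ∀ x, Continuous fun s => F s x := fun x =>
    hF.comp (continuous_id.prodMk continuous_const)
  have hcont' : Continuous fun s => F' s x₀ := hF'.comp (continuous_id.prodMk continuous_const)
  refine intervalIntegral.hasFDerivAt_integral_of_dominated_of_fderiv_le
    (F := fun x s => F s x) (F' := fun x s => F' s x) (bound := fun _ => C)
    (Metric.closedBall_mem_nhds x₀ one_pos)
    (Filter.Eventually.of_forall fun x => (hcont x).aestronglyMeasurable)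
    ((hcont x₀).intervalIntegrable _ _) hcont'.aestronglyMeasurable
    (Filter.Eventually.of_forall fun s hs x hx => hC (s, x) ⟨uIoc_subset_uIcc hs, hx⟩)
    intervalIntegrable_const (Filter.Eventually.of_forall fun s _ x _ => hFF' s x)

end Parametric

section Picard

variable {n : ℕ} {f : EuclideanSpace ℝ (Fin n) → EuclideanSpace ℝ (Fin n)}
  {z : ℝ → EuclideanSpace ℝ (Fin n) → EuclideanSpace ℝ (Fin n)}

/-- `z` is jointly continuous and has a jointly continuous spatial derivative. -/
structure HasContinuousSpatialDeriv
    (z : ℝ → EuclideanSpace ℝ (Fin n) → EuclideanSpace ℝ (Fin n)) : Prop where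
  continuous : Continuous fun q : ℝ × EuclideanSpace ℝ (Fin n) => z q.1 q.2
  differentiable : ∀ t, Differentiable ℝ (z t)
  continuous_fderiv :
    Continuous fun q : ℝ × EuclideanSpace ℝ (Fin n) => fderiv ℝ (z q.1) q.2

namespace HasContinuousSpatialDeriv

theorem zero : HasContinuousSpatialDeriv
    (0 : ℝ → EuclideanSpace ℝ (Fin n) → EuclideanSpace ℝ (Fin n)) where
  continuous := continuous_const
  differentiable _ := differentiable_const 0
  continuous_fderiv := by
    simp only [Pi.zero_apply, fderiv_zero]
    exact continuous_const

theorem continuous_time (hz : HasContinuousSpatialDeriv z) (x : EuclideanSpace ℝ (Fin n)) :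
    Continuous fun t => z t x :=
  hz.continuous.comp (continuous_id.prodMk continuous_const)

theorem continuous_fderiv_comp (hf : ContDiff ℝ 1 f) (hz : HasContinuousSpatialDeriv z) :
    Continuous fun q : ℝ × EuclideanSpace ℝ (Fin n) =>
      (fderiv ℝ f (z q.1 q.2)).comp (fderiv ℝ (z q.1) q.2) :=
  ((hf.continuous_fderiv one_ne_zero).comp hz.continuous).clm_comp hz.continuous_fderiv

theorem hasFDerivAt_picardT (hf : ContDiff ℝ 1 f) (hz : HasContinuousSpatialDeriv z) (t : ℝ)
    (x : EuclideanSpace ℝ (Fin n)) :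
    HasFDerivAt (picardT f z t)
      (ContinuousLinearMap.id ℝ _ +
        ∫ s in (0 : ℝ)..t, (fderiv ℝ f (z s x)).comp (fderiv ℝ (z s) x)) x :=
  (hasFDerivAt_id x).add <| hasFDerivAt_intervalIntegral_of_continuous
    (F := fun s x => f (z s x)) (F' := fun s x => (fderiv ℝ f (z s x)).comp (fderiv ℝ (z s) x))
    (hf.continuous.comp hz.continuous) (hz.continuous_fderiv_comp hf)
    (fun s x => ((hf.differentiable one_ne_zero) _).hasFDerivAt.comp x
      (hz.differentiable s x).hasFDerivAt) 0 t x

theorem picard (hf : ContDiff ℝ 1 f) (hz : HasContinuousSpatialDeriv z) :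
    HasContinuousSpatialDeriv (picardT f z) where
  continuous := by
    refine continuous_snd.add (intervalIntegral.continuous_parametric_intervalIntegral_of_continuous
      (f := fun (q : ℝ × EuclideanSpace ℝ (Fin n)) s => f (z s q.2)) ?_ continuous_fst)
    exact hf.continuous.comp (hz.continuous.comp
      (continuous_snd.prodMk (continuous_snd.comp continuous_fst)))
  differentiable t x := (hz.hasFDerivAt_picardT hf t x).differentiableAt
  continuous_fderiv := by
    simp only [(hz.hasFDerivAt_picardT hf _ _).fderiv]
    refine continuous_const.add
      (intervalIntegral.continuous_parametric_intervalIntegral_of_continuous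
        (f := fun (q : ℝ × EuclideanSpace ℝ (Fin n)) s =>
          (fderiv ℝ f (z s q.2)).comp (fderiv ℝ (z s) q.2)) ?_ continuous_fst)
    exact (hz.continuous_fderiv_comp hf).comp
      (continuous_snd.prodMk (continuous_snd.comp continuous_fst))

theorem picardT_iterate (hf : ContDiff ℝ 1 f) (m : ℕ) :
    HasContinuousSpatialDeriv ((picardT f)^[m] 0) := by
  induction m with
  | zero => exact zero
  | succ m ih =>
    rw [Function.iterate_succ_apply']
    exact ih.picard hf

theorem hasDerivAt_picardT_time (hf : ContDiff ℝ 1 f) (hz : HasContinuousSpatialDeriv z)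
    (x : EuclideanSpace ℝ (Fin n)) (t : ℝ) :
    HasDerivAt (fun t' => picardT f z t' x) (f (z t x)) t :=
  ((hf.continuous.comp (hz.continuous_time x)).integral_hasStrictDerivAt 0 t).hasDerivAt.const_add x

end HasContinuousSpatialDeriv

theorem picardT_zero_time (x : EuclideanSpace ℝ (Fin n)) : picardT f z 0 x = x := by
  simp [picardT]

theorem lipschitz_of_norm_fderiv_le {L : ℝ} (hf : ContDiff ℝ 1 f)
    (hfD : ∀ y, ‖fderiv ℝ f y‖ ≤ L) (x y : EuclideanSpace ℝ (Fin n)) :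
    ‖f x - f y‖ ≤ L * ‖x - y‖ :=
  convex_univ.norm_image_sub_le_of_norm_fderiv_le
    (fun z _ => hf.differentiable one_ne_zero z) (fun z _ => hfD z) (mem_univ y) (mem_univ x)

/-- One Picard step contracts the defect `D_x z [f w] - ∂ₜ z` by the factor `T * L`. -/
theorem picardT_defect_le {L T C : ℝ} (hf : ContDiff ℝ 1 f)
    (hfD : ∀ y, ‖fderiv ℝ f y‖ ≤ L) (hz : HasContinuousSpatialDeriv z)
    {w : EuclideanSpace ℝ (Fin n)} (hz0 : z 0 w = w)
    {z' : ℝ → EuclideanSpace ℝ (Fin n)} (hz' : ∀ t, HasDerivAt (fun t' => z t' w) (z' t) t)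
    (hz'c : Continuous z')
    (hC : ∀ t ∈ Icc 0 T, ‖fderiv ℝ (z t) w (f w) - z' t‖ ≤ C) :
    ∀ t ∈ Icc 0 T, ‖fderiv ℝ (picardT f z t) w (f w) - f (z t w)‖ ≤ T * L * C := by
  intro t ht
  have hL : 0 ≤ L := (norm_nonneg _).trans (hfD 0)
  have hC0 : 0 ≤ C := (norm_nonneg _).trans (hC t ht)
  have hDf : Continuous fun s => fderiv ℝ f (z s w) :=
    (hf.continuous_fderiv one_ne_zero).comp (hz.continuous_time w)
  have hcomp : Continuous fun s => (fderiv ℝ f (z s w)).comp (fderiv ℝ (z s) w) :=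
    (hz.continuous_fderiv_comp hf).comp (continuous_id.prodMk continuous_const)
  have hftc : ∫ s in (0 : ℝ)..t, fderiv ℝ f (z s w) (z' s) = f (z t w) - f w := by
    have h := intervalIntegral.integral_eq_sub_of_hasDerivAt (a := 0) (b := t)
      (f := fun s => f (z s w))
      (fun s _ => (hf.differentiable one_ne_zero (z s w)).hasFDerivAt.comp_hasDerivAt s (hz' s))
      ((hDf.clm_apply hz'c).intervalIntegrable _ _)
    rw [h, hz0]
  have hdef : fderiv ℝ (picardT f z t) w (f w) - f (z t w) =
      ∫ s in (0 : ℝ)..t, fderiv ℝ f (z s w) (fderiv ℝ (z s) w (f w) - z' s) := by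
    simp only [map_sub]
    rw [intervalIntegral.integral_sub, hftc, (hz.hasFDerivAt_picardT hf t w).fderiv,
      add_apply, ContinuousLinearMap.intervalIntegral_apply]
    · simp only [ContinuousLinearMap.id_apply, ContinuousLinearMap.comp_apply]
      abel
    · exact hcomp.intervalIntegrable _ _
    · exact (hcomp.clm_apply continuous_const).intervalIntegrable _ _
    · exact (hDf.clm_apply hz'c).intervalIntegrable _ _
  rw [hdef]
  calc _ ≤ L * C * |t - 0| := by
        refine intervalIntegral.norm_integral_le_of_norm_le_const fun s hs => ?_
        rw [uIoc_of_le ht.1] at hs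
        exact (ContinuousLinearMap.le_opNorm _ _).trans
          (mul_le_mul (hfD _) (hC s ⟨hs.1.le, hs.2.trans ht.2⟩) (norm_nonneg _) hL)
    _ ≤ L * C * T := by
        rw [sub_zero, abs_of_nonneg ht.1]
        exact mul_le_mul_of_nonneg_left ht.2 (mul_nonneg hL hC0)
    _ = T * L * C := by ring

theorem picardT_iterate_defect_le {L T : ℝ} (hf : ContDiff ℝ 1 f) (hf0 : f 0 = 0)
    (hfD : ∀ y, ‖fderiv ℝ f y‖ ≤ L) (w : EuclideanSpace ℝ (Fin n)) (m : ℕ) :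
    ∀ t ∈ Icc 0 T, ‖fderiv ℝ ((picardT f)^[m + 1] 0 t) w (f w) - f ((picardT f)^[m] 0 t w)‖ ≤
      (T * L) ^ m * ‖f w‖ := by
  induction m with
  | zero =>
    intro t _
    have h : (picardT f)^[0 + 1] 0 t = id := by
      funext x
      simp [picardT, hf0]
    rw [h, fderiv_id]
    simp [hf0]
  | succ m ih =>
    intro t ht
    have hz := HasContinuousSpatialDeriv.picardT_iterate hf (m + 1)
    have hy := HasContinuousSpatialDeriv.picardT_iterate hf m
    rw [Function.iterate_succ_apply' _ (m + 1)]
    refine (picardT_defect_le hf hfD hz (z' := fun t => f ((picardT f)^[m] 0 t w)) ?_ ?_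
      (hf.continuous.comp (hy.continuous_time w)) ih t ht).trans_eq (by ring)
    · rw [Function.iterate_succ_apply', picardT_zero_time]
    · intro t
      rw [Function.iterate_succ_apply']
      exact hy.hasDerivAt_picardT_time hf w t

theorem picardT_iterate_sub_solution_le {L T C : ℝ} (hf : ContDiff ℝ 1 f)
    (hfD : ∀ y, ‖fderiv ℝ f y‖ ≤ L) {w : EuclideanSpace ℝ (Fin n)}
    {u : ℝ → EuclideanSpace ℝ (Fin n)} (hu0 : u 0 = w)
    (hu : ∀ t ≥ (0 : ℝ), HasDerivAt u (f (u t)) t) (huC : ∀ t ≥ (0 : ℝ), ‖u t‖ ≤ C) (m : ℕ) :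
    ∀ t ∈ Icc 0 T, ‖(picardT f)^[m] 0 t w - u t‖ ≤ (T * L) ^ m * C := by
  have hL : 0 ≤ L := (norm_nonneg _).trans (hfD 0)
  induction m with
  | zero =>
    intro t ht
    simpa using huC t ht.1
  | succ m ih =>
    intro t ht
    have hy := HasContinuousSpatialDeriv.picardT_iterate hf m
    have hnonneg : ∀ s ∈ uIcc 0 t, 0 ≤ s := fun s hs => by
      rw [uIcc_of_le ht.1] at hs
      exact hs.1
    have hint : IntervalIntegrable (fun s => f (u s)) volume 0 t :=
      ContinuousOn.intervalIntegrable fun s hs =>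
        (hf.continuous.continuousAt.comp (hu s (hnonneg s hs)).continuousAt).continuousWithinAt
    have hftc := intervalIntegral.integral_eq_sub_of_hasDerivAt
      (fun s hs => hu s (hnonneg s hs)) hint
    have hdiff : (picardT f)^[m + 1] 0 t w - u t =
        ∫ s in (0 : ℝ)..t, (f ((picardT f)^[m] 0 s w) - f (u s)) := by
      have hint' : IntervalIntegrable (fun s => f ((picardT f)^[m] 0 s w)) volume 0 t :=
        (hf.continuous.comp (hy.continuous_time w)).intervalIntegrable _ _
      rw [intervalIntegral.integral_sub hint' hint, hftc, Function.iterate_succ_apply', hu0,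
        picardT]
      abel
    have hB : 0 ≤ (T * L) ^ m * C := (norm_nonneg _).trans (ih t ht)
    rw [hdiff]
    calc _ ≤ L * ((T * L) ^ m * C) * |t - 0| := by
          refine intervalIntegral.norm_integral_le_of_norm_le_const fun s hs => ?_
          rw [uIoc_of_le ht.1] at hs
          exact (lipschitz_of_norm_fderiv_le hf hfD _ _).trans
            (mul_le_mul_of_nonneg_left (ih s ⟨hs.1.le, hs.2.trans ht.2⟩) hL)
      _ ≤ L * ((T * L) ^ m * C) * T := by
          rw [sub_zero, abs_of_nonneg ht.1]
          exact mul_le_mul_of_nonneg_left ht.2 (mul_nonneg hL hB)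
      _ = (T * L) ^ (m + 1) * C := by ring

theorem norm_sub_solution_le {L T : ℝ} (hf : ContDiff ℝ 1 f)
    (hfD : ∀ y, ‖fderiv ℝ f y‖ ≤ L) (hT : 0 ≤ T) {u v : ℝ → EuclideanSpace ℝ (Fin n)}
    (hu : ∀ t ≥ (0 : ℝ), HasDerivAt u (f (u t)) t)
    (hv : ∀ t ≥ (0 : ℝ), HasDerivAt v (f (v t)) t) :
    ‖u T - v T‖ ≤ Real.exp (T * L) * ‖u 0 - v 0‖ := by
  have hL : 0 ≤ L := (norm_nonneg _).trans (hfD 0)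
  lift L to NNReal using hL
  have h := dist_le_of_trajectories_ODE (v := fun _ => f) (K := L) (a := 0) (b := T)
    (fun _ => LipschitzWith.of_dist_le_mul fun x y => by
      simpa [dist_eq_norm] using lipschitz_of_norm_fderiv_le hf hfD x y)
    (fun t ht => (hu t ht.1).continuousAt.continuousWithinAt)
    (fun t ht => (hu t ht.1).hasDerivWithinAt)
    (fun t ht => (hv t ht.1).continuousAt.continuousWithinAt)
    (fun t ht => (hv t ht.1).hasDerivWithinAt) le_rfl T ⟨hT, le_rfl⟩
  rw [dist_eq_norm, dist_eq_norm] at h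
  refine h.trans_eq ?_
  rw [sub_zero, mul_comm T, mul_comm]

end Picard

theorem cval_mono {K T L : ℝ} (hK : 0 ≤ K) (hTL : 0 ≤ T * L) (k : ℕ) :
    Monotone fun N => cval K T L N k := fun _ _ h =>
  Finset.sum_le_sum_of_subset_of_nonneg (Finset.range_mono h) fun _ _ _ => by positivity

theorem cval_succ (K T L : ℝ) (N k : ℕ) :
    cval K T L (N + 1) k =
      (Real.exp (T * L) + K * (T * L) ^ k) * cval K T L N k + K ^ 2 * (T * L) ^ k := by
  rw [cval, Finset.sum_range_succ', cval, Finset.mul_sum]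
  simp [pow_succ', mul_assoc]

theorem GIter_sub_solution_le {n : ℕ} {K r L T : ℝ} (hK : 1 ≤ K) (hr : 0 < r)
    {f : EuclideanSpace ℝ (Fin n) → EuclideanSpace ℝ (Fin n)} (hf : ContDiff ℝ 1 f)
    (hfD : ∀ y, ‖fderiv ℝ f y‖ ≤ L)
    {φ : ℝ → EuclideanSpace ℝ (Fin n) → EuclideanSpace ℝ (Fin n)} (hφ0 : ∀ x, φ 0 x = x)
    (hφd : ∀ x, ∀ t ≥ (0 : ℝ), HasDerivAt (fun s => φ s x) (f (φ t x)) t)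
    (hφsemi : ∀ t ≥ (0 : ℝ), ∀ s ≥ (0 : ℝ), ∀ x, φ (t + s) x = φ t (φ s x))
    (hφb : ∀ t ≥ (0 : ℝ), ∀ y ∈ Metric.closedBall (0 : EuclideanSpace ℝ (Fin n)) (2 * K * r),
      ‖φ t y‖ ≤ K * ‖y‖)
    (hT : 0 < T) {N k : ℕ} (hck : cval K T L N k < K)
    {x : EuclideanSpace ℝ (Fin n)} (hx : ‖x‖ ≤ r) :
    ∀ i < N, ‖GIter f T k i T x - φ ((i + 1 : ℕ) * T) x‖ ≤ cval K T L (i + 1) k * ‖x‖ := by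
  have hK0 : 0 ≤ K := zero_le_one.trans hK
  have hTL : 0 ≤ T * L := mul_nonneg hT.le ((norm_nonneg _).trans (hfD 0))
  have hxb : x ∈ Metric.closedBall (0 : EuclideanSpace ℝ (Fin n)) (2 * K * r) := by
    rw [mem_closedBall_zero_iff]
    nlinarith
  have hstep : ∀ w ∈ Metric.closedBall (0 : EuclideanSpace ℝ (Fin n)) (2 * K * r),
      ‖(picardT f)^[k] 0 T w - φ T w‖ ≤ (T * L) ^ k * (K * ‖w‖) := fun w hw =>
    picardT_iterate_sub_solution_le hf hfD (hφ0 w) (hφd w) (fun t ht => hφb t ht w hw) k T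
      ⟨hT.le, le_rfl⟩
  intro i
  induction i with
  | zero =>
    intro _
    have h := hstep x hxb
    simp only [GIter, zero_add, Nat.cast_one, one_mul]
    refine h.trans ?_
    rw [← mul_assoc]
    refine mul_le_mul_of_nonneg_right ?_ (norm_nonneg x)
    simp only [cval, Finset.range_one, Finset.sum_singleton, pow_zero, one_mul]
    have := pow_nonneg hTL k
    nlinarith [mul_nonneg this hK0]
  | succ i ih =>
    intro hi
    have hiN : i < N := (Nat.lt_succ_self i).trans hi
    specialize ih hiN
    simp only [GIter]
    set w := GIter f T k i T x
    set y := φ ((i + 1 : ℕ) * T) x with hy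
    have hiT : (0 : ℝ) ≤ (i + 1 : ℕ) * T := by positivity
    have hyx : ‖y‖ ≤ K * ‖x‖ := hφb _ hiT x hxb
    have hwx : ‖w‖ ≤ ‖w - y‖ + K * ‖x‖ := by
      have := norm_add_le (w - y) y
      rw [sub_add_cancel] at this
      linarith
    have hc : cval K T L (i + 1) k ≤ K := (cval_mono hK0 hTL k hiN).trans hck.le
    have hw : w ∈ Metric.closedBall (0 : EuclideanSpace ℝ (Fin n)) (2 * K * r) := by
      rw [mem_closedBall_zero_iff]
      have h1 := mul_le_mul_of_nonneg_right hc (norm_nonneg x)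
      have h2 := mul_le_mul_of_nonneg_left hx hK0
      linarith
    have hφ : φ ((i + 1 + 1 : ℕ) * T) x = φ T y := by
      rw [hy, ← hφsemi T hT.le _ hiT]
      congr 1
      push_cast
      ring
    have hgr : ‖φ T w - φ T y‖ ≤ Real.exp (T * L) * ‖w - y‖ := by
      simpa only [hφ0] using norm_sub_solution_le hf hfD hT.le (hφd w) (hφd y)
    rw [hφ, cval_succ]
    calc _ ≤ ‖(picardT f)^[k] 0 T w - φ T w‖ + ‖φ T w - φ T y‖ :=
          norm_sub_le_norm_sub_add_norm_sub ..
      _ ≤ (T * L) ^ k * (K * ‖w‖) + Real.exp (T * L) * ‖w - y‖ := add_le_add (hstep w hw) hgr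
      _ ≤ (T * L) ^ k * (K * (‖w - y‖ + K * ‖x‖)) + Real.exp (T * L) * ‖w - y‖ := by gcongr
      _ = (Real.exp (T * L) + K * (T * L) ^ k) * ‖w - y‖ + K ^ 2 * (T * L) ^ k * ‖x‖ := by ring
      _ ≤ (Real.exp (T * L) + K * (T * L) ^ k) * (cval K T L (i + 1) k * ‖x‖) +
          K ^ 2 * (T * L) ^ k * ‖x‖ := by gcongr
      _ = _ := by ring

/-- derivative inequality for the extended Picard iteration: evaluating the
Picard derivative defect at `w := G_iᵏ(T,x)` gives the bound `((TL)ᵏ/T)(K + c(k))‖x‖`. -/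
theorem extended_picard_derivative_inequality {n : ℕ} (K r δ L Q T : ℝ) (hK : 1 ≤ K)
    (hr : 0 < r) (hδ : 0 < δ) (hL : 0 < L)
    (f : EuclideanSpace ℝ (Fin n) → EuclideanSpace ℝ (Fin n))
    (hf : ContDiff ℝ 1 f) (hf0 : f 0 = 0)
    (hfD : ∀ y : EuclideanSpace ℝ (Fin n), ‖fderiv ℝ f y‖ ≤ L)
    (hfQ : ∀ y ∈ Metric.closedBall (0 : EuclideanSpace ℝ (Fin n)) (4 * K * r), ‖f y‖ ≤ Q)
    (φ : ℝ → EuclideanSpace ℝ (Fin n) → EuclideanSpace ℝ (Fin n))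
    (hφ0 : ∀ x, φ 0 x = x)
    (hφd : ∀ x : EuclideanSpace ℝ (Fin n), ∀ t ≥ (0:ℝ),
      HasDerivAt (fun s => φ s x) (f (φ t x)) t)
    (hφsemi : ∀ t ≥ (0:ℝ), ∀ s ≥ (0:ℝ), ∀ x, φ (t + s) x = φ t (φ s x))
    (hφb : ∀ t ≥ (0:ℝ), ∀ y ∈ Metric.closedBall (0 : EuclideanSpace ℝ (Fin n)) (2 * K * r),
      ‖φ t y‖ ≤ K * ‖y‖)
    (hT : 0 < T) (hT1 : T < 2 * K * r / Q) (hT2 : T < 1 / L)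
    (N : ℕ) (hN : δ / T < N)
    (k : ℕ) (hk : 1 ≤ k) (hck : cval K T L N k < K) :
    ∀ x ∈ Metric.closedBall (0 : EuclideanSpace ℝ (Fin n)) r, ∀ i < N,
      ∀ t ∈ Set.Icc (0:ℝ) T,
        ‖fderiv ℝ (fun x' => (picardT f)^[k] 0 t x') (GIter f T k i T x)
            (f (GIter f T k i T x)) -
          deriv (fun t' => (picardT f)^[k] 0 t' (GIter f T k i T x)) t‖ ≤
        (T * L) ^ k / T * (K + cval K T L N k) * ‖x‖ := by
  intro x hx i hi t ht
  rw [mem_closedBall_zero_iff] at hx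
  have hK0 : 0 ≤ K := zero_le_one.trans hK
  have hTL : 0 ≤ T * L := by positivity
  have hdist := GIter_sub_solution_le hK hr hf hfD hφ0 hφd hφsemi hφb hT hck hx i hi
  set w := GIter f T k i T x
  have hw : ‖w‖ ≤ (K + cval K T L N k) * ‖x‖ := by
    have h1 := hφb ((i + 1 : ℕ) * T) (by positivity) x
      (by rw [mem_closedBall_zero_iff]; nlinarith)
    have h2 := mul_le_mul_of_nonneg_right (cval_mono hK0 hTL k hi) (norm_nonneg x)
    have h3 := norm_add_le (w - φ ((i + 1 : ℕ) * T) x) (φ ((i + 1 : ℕ) * T) x)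
    rw [sub_add_cancel] at h3
    linarith
  have hfw : ‖f w‖ ≤ L * ‖w‖ := by
    simpa [hf0] using lipschitz_of_norm_fderiv_le hf hfD w 0
  obtain ⟨m, rfl⟩ : ∃ m, k = m + 1 := ⟨k - 1, by omega⟩
  have hderiv : deriv (fun t' => (picardT f)^[m + 1] 0 t' w) t = f ((picardT f)^[m] 0 t w) := by
    rw [Function.iterate_succ_apply']
    exact ((HasContinuousSpatialDeriv.picardT_iterate hf m).hasDerivAt_picardT_time hf w t).deriv
  rw [hderiv]
  calc _ ≤ (T * L) ^ m * ‖f w‖ := picardT_iterate_defect_le hf hf0 hfD w m t ht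
    _ ≤ (T * L) ^ m * (L * ((K + cval K T L N (m + 1)) * ‖x‖)) := by
        gcongr
        exact hfw.trans (mul_le_mul_of_nonneg_left hw hL.le)
    _ = _ := by
        field_simp
        ring
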